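/- Let A be an n×n real symmetric matrix and u ∈ ℝⁿ a nonzero vector with uᵀAu ≠ 0, and let μ = (1/2)[uᵀu + uᵀA²u − √((uᵀu − uᵀA²u)² + 4(uᵀAu)²)]. Then uᵀu − μ > 0, uᵀA²u − μ > 0, and the homogeneous Rayleigh quotient α = [uᵀA²u − uᵀu + √((uᵀA²u − uᵀu)² + 4(uᵀAu)²)]/(2uᵀAu) satisfies α = (uᵀAu)/(uᵀu − μ) = (uᵀA²u − μ)/(uᵀAu). -/

import Mathlib

open Matrix

theorem abs_sub_lt_sqrt_sub_sq_add (a c : ℝ) {b : ℝ} (hb : b ≠ 0) :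
    |a - c| < Real.sqrt ((a - c) ^ 2 + 4 * b ^ 2) := by
  apply Real.lt_sqrt_of_sq_lt
  rw [sq_abs]
  have : 0 < b ^ 2 := by positivity
  linarith

/-- With `μ = (1/2)[uᵀu + uᵀA²u − √((uᵀu − uᵀA²u)² + 4(uᵀAu)²)]`, we have
`uᵀu − μ > 0`, `uᵀA²u − μ > 0`, and the homogeneous Rayleigh quotient
`α = [uᵀA²u − uᵀu + √((uᵀA²u − uᵀu)² + 4(uᵀAu)²)]/(2uᵀAu)` satisfies
`α = (uᵀAu)/(uᵀu − μ) = (uᵀA²u − μ)/(uᵀAu)`. -/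
theorem homogeneous_rq_formulas
    {n : ℕ} (A : Matrix (Fin n) (Fin n) ℝ) (hA : A.IsSymm)
    (u : Fin n → ℝ) (hu : u ≠ 0) (huAu : u ⬝ᵥ A.mulVec u ≠ 0)
    (μ : ℝ)
    (hμ : μ = (1/2) * (u ⬝ᵥ u + u ⬝ᵥ (A * A).mulVec u -
      Real.sqrt ((u ⬝ᵥ u - u ⬝ᵥ (A * A).mulVec u)^2 + 4 * (u ⬝ᵥ A.mulVec u)^2)))
    (α : ℝ)
    (hα : α = (u ⬝ᵥ (A * A).mulVec u - u ⬝ᵥ u +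
      Real.sqrt ((u ⬝ᵥ (A * A).mulVec u - u ⬝ᵥ u)^2 + 4 * (u ⬝ᵥ A.mulVec u)^2)) /
      (2 * (u ⬝ᵥ A.mulVec u))) :
    0 < u ⬝ᵥ u - μ ∧
    0 < u ⬝ᵥ (A * A).mulVec u - μ ∧
    α = (u ⬝ᵥ A.mulVec u) / (u ⬝ᵥ u - μ) ∧
    α = (u ⬝ᵥ (A * A).mulVec u - μ) / (u ⬝ᵥ A.mulVec u) := by
  generalize u ⬝ᵥ (A * A).mulVec u = c at *
  generalize u ⬝ᵥ A.mulVec u = b at *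
  generalize u ⬝ᵥ u = a at *
  rw [sub_sq_comm c a] at hα
  obtain ⟨hlo, hhi⟩ := abs_lt.mp (abs_sub_lt_sqrt_sub_sq_add a c huAu)
  have hs : Real.sqrt ((a - c) ^ 2 + 4 * b ^ 2) ^ 2 = (a - c) ^ 2 + 4 * b ^ 2 :=
    Real.sq_sqrt (by positivity)
  generalize Real.sqrt ((a - c) ^ 2 + 4 * b ^ 2) = s at *
  have ha : 0 < a - μ := by linarith
  have hc : 0 < c - μ := by linarith
  have hprod : (c - μ) * (a - μ) = b * b := by
    subst hμ
    linear_combination hs / 4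
  have hαc : α = (c - μ) / b := by
    rw [hα, hμ]
    field_simp
    ring
  exact ⟨ha, hc, by rw [hαc, div_eq_div_iff huAu ha.ne', hprod], hαc⟩
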